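/- Let ψ ∈ C^∞_c(ℝ^n) with ψ ≡ 1 on {|x|_∞ ≤ 3/4} and ψ ≡ 0 on {|x|_∞ ≥ 1}. Under the hypotheses of the punctured trapezoidal rule theorem, for each multi-index β with |β| > γ + n there exists a constant A_β, independent of h ∈ (0,h_0) and α with |α|_∞ ≤ 1/2, such that ∫_{ℝ^n} ∑_{ν ≤ β} |h^{|ν|−γ} ∂^ν f(hx)| · |∂^{β−ν}(1 − ψ)(x)| dx ≤ A_β, where f(x) = |x−hα|^γ ℓ(|x−hα|, (x−hα)/|x−hα|) v(x). -/

import Mathlib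

open MeasureTheory Real

noncomputable section

/-- Partial derivative in the `j`-th coordinate direction. -/
def pd (n : ℕ) (j : Fin n) (g : EuclideanSpace ℝ (Fin n) → ℝ) :
    EuclideanSpace ℝ (Fin n) → ℝ :=
  fun x => fderiv ℝ g x (EuclideanSpace.single j 1)

/-- The mixed partial derivative `∂^β` corresponding to the multi-index `β`. -/
def mD (n : ℕ) (β : Fin n → ℕ) (g : EuclideanSpace ℝ (Fin n) → ℝ) :
    EuclideanSpace ℝ (Fin n) → ℝ :=
  (List.finRange n).foldr (fun j f => (pd n j)^[β j] f) g

/-- The direction `x/|x|` of a point. -/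
def sdir (n : ℕ) (x : EuclideanSpace ℝ (Fin n)) : EuclideanSpace ℝ (Fin n) := ‖x‖⁻¹ • x


abbrev EE (n : ℕ) := EuclideanSpace ℝ (Fin n)

/-- Induction principle for families of functions under mixed partial derivatives. -/
lemma mD_ind (n : ℕ) {ι : Type*} (P : ℕ → (ι → EE n → ℝ) → Prop)
    (hP : ∀ k f j, P k f → P (k + 1) (fun i => pd n j (f i)))
    (ν : Fin n → ℕ) (g : ι → EE n → ℝ) (hg : P 0 g) :
    P (∑ j, ν j) (fun i => mD n ν (g i)) := by
  have hit : ∀ (j : Fin n) (m k : ℕ) (f : ι → EE n → ℝ), P k f →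
      P (k + m) (fun i => (pd n j)^[m] (f i)) := by
    intro j m
    induction m with
    | zero => intro k f hf; simpa using hf
    | succ m ih =>
      intro k f hf
      simp only [Function.iterate_succ_apply']
      exact hP _ _ j (ih k f hf)
  have hl : ∀ l : List (Fin n), P ((l.map ν).sum)
      (fun i => l.foldr (fun j f => (pd n j)^[ν j] f) (g i)) := by
    intro l
    induction l with
    | nil => simpa using hg
    | cons a l ih =>
      simp only [List.map_cons, List.sum_cons, List.foldr_cons]
      rw [add_comm]
      exact hit a _ _ _ ih
  have h := hl (List.finRange n)
  have e : ((List.finRange n).map ν).sum = ∑ j, ν j := by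
    rw [← List.ofFn_eq_map, List.sum_ofFn]
  rw [e] at h
  exact h

lemma pd_congr (n : ℕ) {U : Set (EE n)} (hU : IsOpen U) {f g : EE n → ℝ}
    (hfg : ∀ x ∈ U, f x = g x) (j : Fin n) : ∀ x ∈ U, pd n j f x = pd n j g x := by
  intro x hx
  have : f =ᶠ[nhds x] g := by
    filter_upwards [hU.mem_nhds hx] with y hy using hfg y hy
  simp only [pd, this.fderiv_eq]

lemma pd_const (n : ℕ) (c : ℝ) (j : Fin n) (x : EE n) : pd n j (fun _ => c) x = 0 := by
  simp [pd]

/-- Derivatives of a function that is constant on an open set. -/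
lemma mD_const_on (n : ℕ) {U : Set (EE n)} (hU : IsOpen U) (c : ℝ) (f : EE n → ℝ)
    (hf : ∀ x ∈ U, f x = c) (ν : Fin n → ℕ) :
    ∀ x ∈ U, mD n ν f x = if ∑ j, ν j = 0 then c else 0 := by
  refine mD_ind n (ι := Unit)
    (fun k f => ∀ x ∈ U, f () x = if k = 0 then c else 0) ?_ ν (fun _ => f) (by simpa using hf)
  intro k f j h x hx
  change pd n j (f ()) x = _
  rw [pd_congr n hU h j x hx, pd_const]
  simp

lemma mD_smooth (n : ℕ) (f : EE n → ℝ) (hf : ContDiff ℝ (⊤ : ℕ∞) f) (ν : Fin n → ℕ) :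
    Continuous (mD n ν f) := by
  refine ContDiff.continuous (𝕜 := ℝ) (n := (⊤ : ℕ∞)) ?_
  refine mD_ind n (ι := Unit)
    (fun k f => ContDiff ℝ (⊤ : ℕ∞) (f ())) ?_ ν (fun _ => f) hf
  intro k f j h
  exact (h.fderiv_right (m := (⊤ : ℕ∞)) (by simp)).clm_apply contDiff_const

def OmW (n : ℕ) : Set ((ℝ × EE n) × EE n) := {q | q.2 ≠ 0}

lemma isOpen_OmW (n : ℕ) : IsOpen (OmW n) := isOpen_ne_fun continuous_snd continuous_const

lemma mD_scaling (n : ℕ) (γ : ℝ) (f : EE n → EE n → ℝ) (F : (ℝ × EE n) × EE n → ℝ)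
    (hF : ContDiffOn ℝ (⊤ : ℕ∞) F (OmW n))
    (hfF : ∀ p t w, 0 < t → w ≠ 0 → f p (p + t • w) = t ^ γ * F ((t, p), w))
    (ν : Fin n → ℕ) :
    ∃ G : (ℝ × EE n) × EE n → ℝ, ContDiffOn ℝ (⊤ : ℕ∞) G (OmW n) ∧
      ∀ p t w, 0 < t → w ≠ 0 →
        mD n ν (f p) (p + t • w) = t ^ (γ - ((∑ j, ν j : ℕ) : ℝ)) * G ((t, p), w) := by
  refine mD_ind n (ι := EE n)
    (fun k f => ∃ G : (ℝ × EE n) × EE n → ℝ, ContDiffOn ℝ (⊤ : ℕ∞) G (OmW n) ∧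
      ∀ p t w, 0 < t → w ≠ 0 →
        f p (p + t • w) = t ^ (γ - (k : ℝ)) * G ((t, p), w)) ?_ ν f ⟨F, hF, by simpa using hfF⟩
  rintro k f j ⟨G, hG, h⟩
  refine ⟨fun q => fderiv ℝ G q (0, EuclideanSpace.single j 1), ?_, ?_⟩
  · exact (hG.fderiv_of_isOpen (isOpen_OmW n) (m := (⊤ : ℕ∞)) (by simp)).clm_apply contDiffOn_const
  · intro p t w ht hw
    have hmem : ((t, p), w) ∈ OmW n := hw
    have hGd : HasFDerivAt G (fderiv ℝ G ((t, p), w)) ((t, p), w) :=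
      ((hG.contDiffAt ((isOpen_OmW n).mem_nhds hmem)).differentiableAt (by simp)).hasFDerivAt
    have hw' : t⁻¹ • ((p + t • w) - p) = w := by
      rw [add_sub_cancel_left, smul_smul, inv_mul_cancel₀ ht.ne', one_smul]
    have hin : HasFDerivAt (fun y : EE n => ((t, p), t⁻¹ • (y - p)))
        ((0 : EE n →L[ℝ] (ℝ × EE n)).prod (t⁻¹ • ContinuousLinearMap.id ℝ (EE n))) (p + t • w) :=
      (hasFDerivAt_const _ _).prodMk (((hasFDerivAt_id _).sub_const p).const_smul t⁻¹)
    have hGd' : HasFDerivAt G (fderiv ℝ G ((t, p), w)) ((t, p), t⁻¹ • ((p + t • w) - p)) := by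
      rw [hw']; exact hGd
    have hc := (hGd'.comp (p + t • w) hin).const_mul (t ^ (γ - (k : ℝ)))
    have hev : f p =ᶠ[nhds (p + t • w)]
        fun y => t ^ (γ - (k : ℝ)) * (G ∘ fun y : EE n => ((t, p), t⁻¹ • (y - p))) y := by
      have : {y : EE n | y ≠ p} ∈ nhds (p + t • w) := by
        apply isOpen_ne.mem_nhds
        simp [ht.ne', hw]
      filter_upwards [this] with y hy
      have := h p t (t⁻¹ • (y - p)) ht (by simp [ht.ne', sub_ne_zero.2 hy])
      rw [smul_smul, mul_inv_cancel₀ ht.ne', one_smul, add_sub_cancel] at this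
      exact this
    have := (hc.congr_of_eventuallyEq hev).fderiv
    simp only [pd]
    rw [this]
    have e : ((0 : ℝ × EE n), t⁻¹ • (EuclideanSpace.single j (1 : ℝ) : EE n))
        = t⁻¹ • ((0 : ℝ × EE n), (EuclideanSpace.single j (1 : ℝ) : EE n)) := by simp
    have e2 : t ^ (γ - ((k + 1 : ℕ) : ℝ)) = t ^ (γ - (k : ℝ)) * t⁻¹ := by
      rw [← Real.rpow_neg_one t, ← Real.rpow_add ht]; congr 1; push_cast; ring
    simp only [ContinuousLinearMap.smul_apply, ContinuousLinearMap.comp_apply,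
      ContinuousLinearMap.prod_apply, ContinuousLinearMap.zero_apply,
      ContinuousLinearMap.id_apply, smul_eq_mul]
    rw [e, map_smul, e2, smul_eq_mul, mul_assoc]

lemma norm_le_sqrt (n : ℕ) (x : EE n) (hx : ∀ i, |x i| ≤ 1) : ‖x‖ ≤ Real.sqrt n := by
  rw [EuclideanSpace.norm_eq]
  apply Real.sqrt_le_sqrt
  calc ∑ i, ‖x i‖ ^ 2 ≤ ∑ i : Fin n, (1 : ℝ) := by
        apply Finset.sum_le_sum
        intro i _
        rw [Real.norm_eq_abs]
        have := hx i
        have := abs_nonneg (x i)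
        nlinarith
    _ = n := by simp

/-- The uniform pointwise derivative bound for the singular integrand. -/
lemma f_bound (n : ℕ) (L γ : ℝ)
    (ℓ : ℝ × EE n → ℝ) (hℓ : ContDiff ℝ (⊤ : ℕ∞) ℓ)
    (v : EE n → ℝ) (hv : ContDiff ℝ (⊤ : ℕ∞) v)
    (hvsupp : ∀ x, L ≤ ‖x‖ → v x = 0) (R : ℝ) (ν : Fin n → ℕ) :
    ∃ M : ℝ, 0 ≤ M ∧ ∀ p y : EE n, ‖p‖ ≤ R → y ≠ p →
      |mD n ν (fun y => ‖y - p‖ ^ γ * ℓ (‖y - p‖, sdir n (y - p)) * v y) y|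
        ≤ M * ‖y - p‖ ^ (γ - ((∑ j, ν j : ℕ) : ℝ)) := by
  have hF : ContDiffOn ℝ (⊤ : ℕ∞) (fun q : (ℝ × EE n) × EE n =>
      ‖q.2‖ ^ γ * ℓ (q.1.1 * ‖q.2‖, ‖q.2‖⁻¹ • q.2) * v (q.1.2 + q.1.1 • q.2)) (OmW n) := by
    have hn : ContDiffOn ℝ (⊤ : ℕ∞) (fun q : (ℝ × EE n) × EE n => ‖q.2‖) (OmW n) :=
      contDiff_snd.contDiffOn.norm ℝ (fun q hq => hq)
    have hn0 : ∀ q ∈ OmW n, ‖q.2‖ ≠ 0 := fun q hq => norm_ne_zero_iff.2 hq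
    have h1 : ContDiff ℝ (⊤ : ℕ∞) (fun q : (ℝ × EE n) × EE n => q.1.1) := by fun_prop
    have h2 : ContDiff ℝ (⊤ : ℕ∞) (fun q : (ℝ × EE n) × EE n => q.1.2 + q.1.1 • q.2) := by
      fun_prop
    refine ((hn.rpow_const_of_ne hn0).mul (hℓ.comp_contDiffOn ?_)).mul (hv.comp h2).contDiffOn
    exact (h1.contDiffOn.mul hn).prodMk ((hn.inv hn0).smul contDiff_snd.contDiffOn)
  obtain ⟨G, hG, hGe⟩ := mD_scaling n γ
    (fun p y => ‖y - p‖ ^ γ * ℓ (‖y - p‖, sdir n (y - p)) * v y) _ hF (by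
      intro p t w ht hw
      have hs : sdir n (t • w) = ‖w‖⁻¹ • w := by
        rw [sdir, norm_smul, Real.norm_of_nonneg ht.le, smul_smul]
        congr 1
        have := norm_ne_zero_iff.2 hw
        field_simp
      simp only [add_sub_cancel_left]
      rw [hs, norm_smul, Real.norm_of_nonneg ht.le, Real.mul_rpow ht.le (norm_nonneg _)]
      ring) ν
  let K : Set ((ℝ × EE n) × EE n) :=
    (Set.Icc 0 (L + R) ×ˢ Metric.closedBall 0 R) ×ˢ Metric.sphere 0 1
  have hK : IsCompact K :=
    (isCompact_Icc.prod (isCompact_closedBall _ _)).prod (isCompact_sphere _ _)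
  have hKO : K ⊆ OmW n := by
    rintro ⟨⟨t, p⟩, w⟩ ⟨_, hw⟩
    have : ‖w‖ = 1 := by simpa using hw
    change w ≠ 0
    rintro rfl
    simp at this
  obtain ⟨M, hM⟩ := hK.exists_bound_of_continuousOn (hG.continuousOn.mono hKO)
  refine ⟨max M 0, le_max_right _ _, ?_⟩
  intro p y hp hy
  have hr : 0 < ‖y - p‖ := norm_pos_iff.2 (sub_ne_zero.2 hy)
  by_cases hyL : L < ‖y‖
  · have hU : IsOpen {y : EE n | L < ‖y‖} := isOpen_lt continuous_const continuous_norm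
    rw [mD_const_on n hU 0 _ (fun x hx => by rw [hvsupp x (le_of_lt hx), mul_zero]) ν y hyL]
    simp only [ite_self, abs_zero]
    positivity
  · have hw : ‖y - p‖⁻¹ • (y - p) ≠ 0 := by simp [sub_ne_zero.2 hy]
    have h := hGe p ‖y - p‖ (‖y - p‖⁻¹ • (y - p)) hr hw
    rw [smul_smul, mul_inv_cancel₀ hr.ne', one_smul, add_sub_cancel] at h
    rw [h, abs_mul, abs_of_nonneg (Real.rpow_nonneg hr.le _), mul_comm]
    gcongr
    refine le_trans (hM _ ⟨⟨⟨hr.le, ?_⟩, ?_⟩, ?_⟩) (le_max_left _ _)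
    · have := norm_sub_le y p
      change ‖y - p‖ ≤ _
      linarith
    · simpa using hp
    · simp [norm_smul, hr.ne']

/-- Pointwise bound for one summand of the integrand. -/
lemma term_bound (n : ℕ) (L : ℝ) (γ : ℝ)
    (ℓ : ℝ × EE n → ℝ) (hℓ : ContDiff ℝ (⊤ : ℕ∞) ℓ)
    (v : EE n → ℝ) (hv : ContDiff ℝ (⊤ : ℕ∞) v)
    (hvsupp : ∀ x, L ≤ ‖x‖ → v x = 0)
    (ψ : EE n → ℝ) (hψ : ContDiff ℝ (⊤ : ℕ∞) ψ)
    (hψ1 : ∀ x : EE n, (∀ i, |x i| ≤ 3 / 4) → ψ x = 1)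
    (hψ0 : ∀ x : EE n, (∃ i, 1 ≤ |x i|) → ψ x = 0)
    (ν μ : Fin n → ℕ) (b : ℕ) (hb : ∑ j, ν j + ∑ j, μ j = b) (hβ : γ - b ≤ 0) :
    ∃ C : ℝ, 0 ≤ C ∧ ∀ h : ℝ, 0 < h → h ≤ 1 → ∀ α : EE n, (∀ i, |α i| ≤ 1 / 2) → ∀ x : EE n,
      ‖h ^ (((∑ j, ν j : ℕ) : ℝ) - γ) * mD n ν (fun y => ‖y - h • α‖ ^ γ *
          ℓ (‖y - h • α‖, sdir n (y - h • α)) * v y) (h • x)‖ *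
        ‖mD n μ (fun y => 1 - ψ y) x‖ ≤ C * (1 + ‖x‖) ^ (γ - b) := by
  obtain ⟨M, hM0, hM⟩ := f_bound n L γ ℓ hℓ v hv hvsupp (Real.sqrt n) ν
  have hs0 : 0 ≤ Real.sqrt n := Real.sqrt_nonneg _
  obtain ⟨N, hN⟩ := (isCompact_closedBall (0 : EE n) (Real.sqrt n)).exists_bound_of_continuousOn
    (mD_smooth n (fun y => 1 - ψ y) (contDiff_const.sub hψ) μ).continuousOn
  have hU : IsOpen {x : EE n | ∀ i, |x i| < 3 / 4} := by
    simp only [Set.setOf_forall]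
    exact isOpen_iInter_of_finite fun i => isOpen_lt (by fun_prop) continuous_const
  have hV : IsOpen {x : EE n | Real.sqrt n < ‖x‖} := isOpen_lt continuous_const continuous_norm
  have hUz := mD_const_on n hU 0 (fun y => 1 - ψ y)
    (fun x hx => by rw [hψ1 x (fun i => (hx i).le)]; ring) μ
  have hVz := mD_const_on n hV 1 (fun y => 1 - ψ y) (fun x hx => by
    rw [hψ0 x ?_, sub_zero]
    by_contra hcon
    push Not at hcon
    exact absurd (norm_le_sqrt n x (fun i => (hcon i).le)) (not_le.2 hx)) μ
  set c : ℝ := (1 + 4 * (1 + Real.sqrt n))⁻¹ with hc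
  have hcpos : 0 < c := by positivity
  set N' := max N 1 * (2 * Real.sqrt n) ^ (∑ j, μ j) + 1 with hN'
  have hN'1 : 1 ≤ N' := by
    have : 0 ≤ max N 1 := le_trans zero_le_one (le_max_right _ _)
    rw [hN']; nlinarith [mul_nonneg this (pow_nonneg (by positivity : 0 ≤ 2 * Real.sqrt n) (∑ j, μ j))]
  refine ⟨M * N' * c ^ (γ - b), by positivity, ?_⟩
  intro h hh hh1 α hα x
  have hαn : ‖α‖ ≤ Real.sqrt n := norm_le_sqrt n α (fun i => (hα i).trans (by norm_num))
  by_cases hx : ∀ i, |x i| < 3 / 4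
  · rw [hUz x hx]
    simp only [ite_self, norm_zero, mul_zero]
    positivity
  push Not at hx
  obtain ⟨i, hi⟩ := hx
  set r := ‖x - α‖ with hrdef
  have hr4 : 1 / 4 ≤ r := by
    have h1 : |(x - α) i| ≤ r := by
      simpa [Real.norm_eq_abs] using PiLp.norm_apply_le (x - α) i
    have h2 : |x i| - |α i| ≤ |(x - α) i| := by
      simpa using abs_sub_abs_le_abs_sub (x i) (α i)
    have := hα i
    linarith
  have hr0 : 0 < r := by linarith
  have hrc : c * (1 + ‖x‖) ≤ r := by
    have h1 : ‖x‖ ≤ r + ‖α‖ := by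
      have := norm_add_le (x - α) α
      simpa using this
    rw [hc, inv_mul_le_iff₀ (by positivity)]
    nlinarith
  have hsm : h • x - h • α = h • (x - α) := (smul_sub _ _ _).symm
  have hnr : ‖h • x - h • α‖ = h * r := by
    rw [hsm, norm_smul, Real.norm_of_nonneg hh.le]
  have hfb := hM (h • α) (h • x) (by
    rw [norm_smul, Real.norm_of_nonneg hh.le]
    nlinarith [norm_nonneg α]) (by
    intro he
    rw [he, sub_self, norm_zero] at hnr
    have := mul_pos hh hr0
    linarith)
  rw [hnr] at hfb
  set a := ∑ j, ν j with ha
  set m := ∑ j, μ j with hm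
  have h1 : ‖h ^ ((a : ℝ) - γ) * mD n ν (fun y => ‖y - h • α‖ ^ γ *
          ℓ (‖y - h • α‖, sdir n (y - h • α)) * v y) (h • x)‖ ≤ M * r ^ (γ - a) := by
    rw [norm_mul, Real.norm_of_nonneg (Real.rpow_nonneg hh.le _), Real.norm_eq_abs]
    calc _ ≤ h ^ ((a : ℝ) - γ) * (M * (h * r) ^ (γ - a)) := by gcongr
      _ = M * r ^ (γ - a) * (h ^ ((a : ℝ) - γ) * h ^ (γ - a)) := by
          rw [Real.mul_rpow hh.le hr0.le]; ring
      _ = M * r ^ (γ - a) := by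
          rw [← Real.rpow_add hh]; simp
  have h2 : ‖mD n μ (fun y => 1 - ψ y) x‖ * r ^ m ≤ N' := by
    by_cases hxn : Real.sqrt n < ‖x‖
    · rw [hVz x hxn]
      by_cases hm0 : m = 0
      · simp [hm0, hN'1]
      · simp only [hm0, if_false, norm_zero, zero_mul]
        linarith
    · push Not at hxn
      have hr2 : r ≤ 2 * Real.sqrt n := by
        have := norm_sub_le x α
        linarith
      have := hN x (by simpa using hxn)
      calc _ ≤ max N 1 * (2 * Real.sqrt n) ^ m := by
            gcongr
            exact this.trans (le_max_left _ _)
        _ ≤ N' := by rw [hN']; linarith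
  have hra : r ^ (γ - a) = r ^ (γ - b) * r ^ m := by
    rw [← Real.rpow_natCast r m, ← Real.rpow_add hr0]
    congr 1
    have : (a : ℝ) + m = b := by exact_mod_cast hb
    linarith
  have h3 : r ^ (γ - b) ≤ c ^ (γ - b) * (1 + ‖x‖) ^ (γ - b) := by
    rw [← Real.mul_rpow hcpos.le (by positivity)]
    exact Real.rpow_le_rpow_of_nonpos (by positivity) hrc hβ
  calc _ ≤ M * r ^ (γ - a) * ‖mD n μ (fun y => 1 - ψ y) x‖ := by gcongr
    _ = M * (‖mD n μ (fun y => 1 - ψ y) x‖ * r ^ m) * r ^ (γ - b) := by rw [hra]; ring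
    _ ≤ M * N' * (c ^ (γ - b) * (1 + ‖x‖) ^ (γ - b)) := by gcongr
    _ = _ := by ring

/-- under the hypotheses of the punctured trapezoidal rule error
theorem, for each multi-index `β` with `|β| > γ + n`, there is a constant `A_β`
independent of `h ∈ (0,h₀)` and of `α` (with `|α|_∞ ≤ 1/2`) such that
`∫ ∑_{ν ≤ β} |h^{|ν|-γ} ∂^ν f(hx)| |∂^{β-ν}(1-ψ)(x)| dx ≤ A_β`, where
`f(x) = |x-hα|^γ ℓ(|x-hα|,(x-hα)/|x-hα|) v(x)`.  The multi-indices `ν ≤ β` are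
encoded as dependent functions `ν : (j : Fin n) → Fin (β j + 1)`. -/
theorem derivatives_of_integrand_bound (n : ℕ) (h₀ L L' : ℝ)
    (hh₀ : 0 < h₀) (hh₀1 : h₀ ≤ 1)
    (hL : 0 < L + (3 / 2) * h₀ * Real.sqrt n)
    (hLL' : L + (3 / 2) * h₀ * Real.sqrt n < L')
    (γ : ℝ) (hγ : -(n : ℝ) < γ)
    (ℓ : ℝ × EuclideanSpace ℝ (Fin n) → ℝ) (hℓ : ContDiff ℝ (⊤ : ℕ∞) ℓ)
    (hℓb : ∃ M : ℝ, ∀ p, |ℓ p| ≤ M)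
    (v : EuclideanSpace ℝ (Fin n) → ℝ) (hv : ContDiff ℝ (⊤ : ℕ∞) v)
    (hvsupp : ∀ x, L ≤ ‖x‖ → v x = 0)
    (ψ : EuclideanSpace ℝ (Fin n) → ℝ) (hψ : ContDiff ℝ (⊤ : ℕ∞) ψ)
    (hψc : HasCompactSupport ψ)
    (hψ1 : ∀ x : EuclideanSpace ℝ (Fin n), (∀ i, |x i| ≤ 3 / 4) → ψ x = 1)
    (hψ0 : ∀ x : EuclideanSpace ℝ (Fin n), (∃ i, 1 ≤ |x i|) → ψ x = 0)
    (β : Fin n → ℕ) (hβ : γ + n < ((∑ j, β j : ℕ) : ℝ)) :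
    ∃ A : ℝ, ∀ h : ℝ, 0 < h → h < h₀ →
      ∀ α : EuclideanSpace ℝ (Fin n), (∀ i, |α i| ≤ 1 / 2) →
        (∫⁻ x : EuclideanSpace ℝ (Fin n),
          ∑ ν : (j : Fin n) → Fin (β j + 1),
            (‖h ^ (((∑ j, (ν j : ℕ) : ℕ) : ℝ) - γ) *
              mD n (fun j => (ν j : ℕ))
                (fun y => ‖y - h • α‖ ^ γ *
                  ℓ (‖y - h • α‖, sdir n (y - h • α)) * v y) (h • x)‖₊ : ENNReal) *
            (‖mD n (fun j => β j - (ν j : ℕ)) (fun y => 1 - ψ y) x‖₊ : ENNReal))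
          ≤ ENNReal.ofReal A := by
  set b : ℕ := ∑ j, β j with hb
  have hγb : γ - b ≤ 0 := by
    have : (0 : ℝ) ≤ n := Nat.cast_nonneg n
    linarith
  have key := fun ν : (j : Fin n) → Fin (β j + 1) =>
    term_bound n L γ ℓ hℓ v hv hvsupp ψ hψ hψ1 hψ0 (fun j => (ν j : ℕ))
      (fun j => β j - (ν j : ℕ)) b (by
        rw [← Finset.sum_add_distrib, hb]
        refine Finset.sum_congr rfl fun j _ => ?_
        have := (ν j).2
        omega) hγb
  choose C hC0 hC using key
  have hint : Integrable (fun x : EuclideanSpace ℝ (Fin n) =>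
      (∑ ν, C ν) * (1 + ‖x‖) ^ (γ - b)) := by
    have := integrable_one_add_norm (E := EuclideanSpace ℝ (Fin n)) (μ := volume)
      (r := (b : ℝ) - γ) (by simp; linarith)
    rw [neg_sub] at this
    exact this.const_mul _
  have hS : 0 ≤ ∑ ν, C ν := Finset.sum_nonneg fun ν _ => hC0 ν
  refine ⟨∫ x : EuclideanSpace ℝ (Fin n), (∑ ν, C ν) * (1 + ‖x‖) ^ (γ - b), ?_⟩
  intro h hh hhh α hα
  rw [ofReal_integral_eq_lintegral_ofReal hint
    (Filter.Eventually.of_forall fun x => by positivity)]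
  refine lintegral_mono fun x => ?_
  rw [Finset.sum_mul, ENNReal.ofReal_sum_of_nonneg
    (fun ν _ => mul_nonneg (hC0 ν) (by positivity))]
  refine Finset.sum_le_sum fun ν _ => ?_
  rw [← ENNReal.coe_mul, ← nnnorm_mul, ← enorm_eq_nnnorm, ← ofReal_norm_eq_enorm, norm_mul]
  exact ENNReal.ofReal_le_ofReal (hC ν h hh (hhh.le.trans hh₀1) α hα x)
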